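/- Let k be a field, r ≥ 1 and V = k^r. Two pairs of complete flags ((U_i), (U′_j)) and ((W_i), (W′_j)) in V lie in the same orbit of the diagonal action of GL(V) on pairs of complete flags if and only if dim(U_i ∩ U′_j) = dim(W_i ∩ W′_j) for all 0 ≤ i, j ≤ r; moreover the number of GL(V)-orbits on pairs of complete flags is r!. (The G-orbits on 𝔅 × 𝔅 are in bijection with the symmetric group 𝔖_r.) -/

import Mathlib

open Module LinearMap Finset

/-- A complete flag `0 = U_0 ⊂ U_1 ⊂ ⋯ ⊂ U_r = V` in `V = k^r`, normalized by
`U_i = ⊤` for `i ≥ r`. -/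
def IsCompleteFlag (k : Type*) [Field k] (r : ℕ)
    (U : ℕ → Submodule k (Fin r → k)) : Prop :=
  (∀ i, U i ≤ U (i + 1)) ∧ (∀ i ≤ r, finrank k (U i) = i) ∧ ∀ i, r ≤ i → U i = ⊤

/-- Two pairs of flags are in the same orbit of the diagonal `GL(V)`-action. -/
def sameOrbitPairs (k : Type*) [Field k] (r : ℕ)
    (U U' W W' : ℕ → Submodule k (Fin r → k)) : Prop :=
  ∃ g : (Fin r → k) ≃ₗ[k] (Fin r → k),
    (∀ i, (U i).map g.toLinearMap = W i) ∧ ∀ j, (U' j).map g.toLinearMap = W' j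

/-- The flag spanned by a basis `b` enumerated in the order given by the permutation `σ`. -/
def spanFlag {k : Type*} [Field k] {r : ℕ} (b : Basis (Fin r) k (Fin r → k))
    (σ : Equiv.Perm (Fin r)) (j : ℕ) : Submodule k (Fin r → k) :=
  Submodule.span k (b '' {m | (σ m : ℕ) < j})

/-- The number of `m < i` with `σ m < j`. -/
def permRank {r : ℕ} (σ : Equiv.Perm (Fin r)) (i j : ℕ) : ℕ :=
  #{m : Fin r | (m : ℕ) < i ∧ (σ m : ℕ) < j}

lemma permRank_succ {r : ℕ} (σ : Equiv.Perm (Fin r)) (m : Fin r) (j : ℕ) :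
    permRank σ (m + 1) j = permRank σ m j + if (σ m : ℕ) < j then 1 else 0 := by
  unfold permRank
  split_ifs with h
  · have : ({x : Fin r | (x : ℕ) < m + 1 ∧ (σ x : ℕ) < j} : Finset (Fin r)) =
        insert m ({x : Fin r | (x : ℕ) < m ∧ (σ x : ℕ) < j} : Finset (Fin r)) := by
      ext x
      simp only [Finset.mem_filter, Finset.mem_univ, true_and, Finset.mem_insert]
      by_cases hx : x = m
      · subst hx; simp [h]
      · have : (x : ℕ) ≠ m := fun e => hx (Fin.ext e)
        simp only [hx, false_or, and_congr_left_iff]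
        omega
    rw [this, Finset.card_insert_of_notMem (by simp)]
  · rw [add_zero]
    refine congrArg Finset.card (Finset.ext fun x => ?_)
    simp only [Finset.mem_filter, Finset.mem_univ, true_and]
    by_cases hx : x = m
    · subst hx; simp [h]
    · have : (x : ℕ) ≠ m := fun e => hx (Fin.ext e)
      simp only [and_congr_left_iff]
      omega

lemma perm_eq_of_permRank_eq {r : ℕ} {σ τ : Equiv.Perm (Fin r)}
    (h : ∀ i ≤ r, ∀ j ≤ r, permRank σ i j = permRank τ i j) : σ = τ := by
  have key : ∀ m : Fin r, ∀ j ≤ r, ((σ m : ℕ) < j ↔ (τ m : ℕ) < j) := by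
    intro m j hj
    have h1 := h (m + 1) m.2 j hj
    rw [permRank_succ, permRank_succ, h m m.2.le j hj] at h1
    split_ifs at h1 <;> omega
  ext m
  have h1 := (key m (σ m + 1) (σ m).2).1 (Nat.lt_succ_self _)
  have h2 := (key m (τ m + 1) (τ m).2).2 (Nat.lt_succ_self _)
  omega

lemma finrank_span_basis_image {k ι V : Type*} [Field k] [AddCommGroup V] [Module k V]
    (b : Basis ι k V) {s : Set ι} {t : Finset ι} (h : ∀ x, x ∈ s ↔ x ∈ t) :
    finrank k (Submodule.span k (b '' s)) = #t := by
  classical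
  obtain rfl : s = t := Set.ext h
  rw [← Finset.coe_image, finrank_span_finset_eq_card, Finset.card_image_of_injective _ b.injective]
  rw [Finset.coe_image]
  exact b.linearIndependent.linearIndepOn_id.mono (Set.image_subset_range _ _)

lemma span_basis_image_inf {k ι V : Type*} [Field k] [AddCommGroup V] [Module k V]
    (b : Basis ι k V) (s t : Set ι) :
    Submodule.span k (b '' s) ⊓ Submodule.span k (b '' t) = Submodule.span k (b '' (s ∩ t)) := by
  ext x
  simp [Basis.mem_span_image]

section spanFlag

variable {k : Type*} [Field k] {r : ℕ} (b : Basis (Fin r) k (Fin r → k))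

lemma finrank_spanFlag_inf (σ : Equiv.Perm (Fin r)) (i j : ℕ) :
    finrank k (spanFlag b 1 i ⊓ spanFlag b σ j : Submodule k (Fin r → k)) = permRank σ i j := by
  rw [spanFlag, spanFlag, span_basis_image_inf, permRank]
  exact finrank_span_basis_image b fun m => by simp

lemma card_perm_lt (σ : Equiv.Perm (Fin r)) {j : ℕ} (hj : j ≤ r) :
    #{m : Fin r | (σ m : ℕ) < j} = j := by
  rw [← Finset.card_map σ.toEmbedding]
  have : ({m : Fin r | (σ m : ℕ) < j} : Finset (Fin r)).map σ.toEmbedding =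
      ({m : Fin r | (m : ℕ) < j} : Finset (Fin r)) := by
    ext x
    simp only [Finset.mem_map_equiv, Finset.mem_filter, Finset.mem_univ, true_and,
      Equiv.apply_symm_apply]
  rw [this, Fin.card_filter_val_lt, min_eq_right hj]

lemma finrank_spanFlag (σ : Equiv.Perm (Fin r)) {j : ℕ} (hj : j ≤ r) :
    finrank k (spanFlag b σ j) = j := by
  rw [spanFlag, ← card_perm_lt σ hj]
  exact finrank_span_basis_image b fun m => by simp [card_perm_lt σ hj]

lemma isCompleteFlag_spanFlag (σ : Equiv.Perm (Fin r)) : IsCompleteFlag k r (spanFlag b σ) := by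
  refine ⟨fun i => Submodule.span_mono (Set.image_mono fun m hm => ?_),
    fun i hi => finrank_spanFlag b σ hi, fun i hi => ?_⟩
  · exact Nat.lt_succ_of_lt hm
  · have : {m : Fin r | (σ m : ℕ) < i} = Set.univ :=
      Set.eq_univ_of_forall fun m => (σ m).2.trans_le hi
    rw [spanFlag, this, Set.image_univ, b.span_eq]

lemma map_spanFlag (b' : Basis (Fin r) k (Fin r → k)) (σ : Equiv.Perm (Fin r)) (j : ℕ) :
    (spanFlag b σ j).map (b.equiv b' (Equiv.refl _)).toLinearMap = spanFlag b' σ j := by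
  rw [spanFlag, Submodule.map_span, ← Set.image_comp, spanFlag]
  congr 2
  ext m
  simp

end spanFlag

namespace IsCompleteFlag

variable {k : Type*} [Field k] {r : ℕ} {U U' : ℕ → Submodule k (Fin r → k)}

lemma monotone (hU : IsCompleteFlag k r U) : Monotone U := monotone_nat_of_le_succ hU.1

lemma sup_span_singleton (hU : IsCompleteFlag k r U) {i : ℕ} (hi : i < r) {v : Fin r → k}
    (hv : v ∈ U (i + 1)) (hv' : v ∉ U i) : U i ⊔ Submodule.span k {v} = U (i + 1) := by
  have hle : U i ⊔ Submodule.span k {v} ≤ U (i + 1) :=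
    sup_le (hU.1 i) ((Submodule.span_singleton_le_iff_mem _ _).2 hv)
  refine Submodule.eq_of_le_of_finrank_le hle ?_
  have hlt : U i < U i ⊔ Submodule.span k {v} := by
    refine lt_of_le_of_ne le_sup_left fun h => hv' ?_
    rw [h]
    exact Submodule.mem_sup_right (Submodule.mem_span_singleton_self v)
  have := Submodule.finrank_lt_finrank_of_lt hlt
  rw [hU.2.1 i hi.le] at this
  rw [hU.2.1 (i + 1) hi]
  exact this

lemma eq_span_of_mem_of_notMem (hU : IsCompleteFlag k r U) {v : Fin r → Fin r → k}
    (hv : ∀ m : Fin r, v m ∈ U (m + 1)) (hv' : ∀ m : Fin r, v m ∉ U m) {i : ℕ} (hi : i ≤ r) :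
    U i = Submodule.span k (v '' {m | (m : ℕ) < i}) := by
  induction i with
  | zero => simpa using Submodule.finrank_eq_zero.1 (hU.2.1 0 hi)
  | succ i ih =>
    rw [← hU.sup_span_singleton hi (hv ⟨i, hi⟩) (hv' ⟨i, hi⟩), ih (Nat.le_of_succ_le hi),
      ← Submodule.span_union]
    congr 1
    have : {m : Fin r | (m : ℕ) < i + 1} = {m : Fin r | (m : ℕ) < i} ∪ {⟨i, hi⟩} := by
      ext m
      simp only [Set.mem_ofPred_eq, Set.mem_union, Set.mem_singleton_iff, Fin.ext_iff]
      omega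
    rw [this, Set.image_union, Set.image_singleton]

lemma eq_spanFlag_of_mem (hU : IsCompleteFlag k r U) {b : Basis (Fin r) k (Fin r → k)}
    {σ : Equiv.Perm (Fin r)} (h : ∀ m, b m ∈ U (σ m + 1)) : U = spanFlag b σ := by
  ext1 j
  rcases le_total j r with hj | hj
  · refine (Submodule.eq_of_le_of_finrank_eq (Submodule.span_le.2 ?_) ?_).symm
    · rintro _ ⟨m, hm, rfl⟩
      exact hU.monotone (Nat.succ_le_of_lt hm) (h m)
    · rw [hU.2.1 j hj]
      exact finrank_spanFlag b σ hj
  · rw [hU.2.2 j hj, (isCompleteFlag_spanFlag b σ).2.2 j hj]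

/-- Any two complete flags admit a common adapted basis. -/
lemma exists_eq_spanFlag (hU : IsCompleteFlag k r U) (hU' : IsCompleteFlag k r U') :
    ∃ (b : Basis (Fin r) k (Fin r → k)) (σ : Equiv.Perm (Fin r)),
      U = spanFlag b 1 ∧ U' = spanFlag b σ := by
  classical
  have hjump : ∀ m : Fin r, ∃ s : Fin r, ∃ v, v ∈ U (m + 1) ∧ v ∉ U m ∧ v ∈ U' (s + 1) ∧
      U (m + 1) ⊓ U' s ≤ U m := by
    intro m
    have hex : ∃ j, ¬ U (m + 1) ⊓ U' j ≤ U m := by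
      refine ⟨r, fun h => ?_⟩
      rw [hU'.2.2 r le_rfl, inf_top_eq] at h
      have := Submodule.finrank_mono h
      rw [hU.2.1 _ m.2, hU.2.1 _ m.2.le] at this
      omega
    have hspec := Nat.find_spec hex
    have hr : Nat.find hex ≤ r := by
      by_contra! hlt
      refine Nat.find_min hex hlt ?_
      rwa [hU'.2.2 r le_rfl, ← hU'.2.2 _ hlt.le]
    have hpos : Nat.find hex ≠ 0 := by
      intro h0
      rw [h0, Submodule.finrank_eq_zero.1 (hU'.2.1 0 (Nat.zero_le r))] at hspec
      simp at hspec
    obtain ⟨s, hs⟩ := Nat.exists_eq_succ_of_ne_zero hpos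
    obtain ⟨v, hv, hvm⟩ := SetLike.not_le_iff_exists.1 hspec
    rw [hs] at hv
    exact ⟨⟨s, by omega⟩, v, hv.1, hvm, hv.2,
      not_not.1 (Nat.find_min hex (show s < Nat.find hex by omega))⟩
  choose s v hv hv' hvs hs using hjump
  have hnot : ∀ m, v m ∉ U' (s m) := fun m h => hv' m (hs m ⟨hv m, h⟩)
  have hne : ∀ m m' : Fin r, m < m' → s m ≠ s m' := by
    intro m m' hlt he
    have hmem : v m' ∈ U' (s m + 1) := he ▸ hvs m'
    rw [← hU'.sup_span_singleton (s m).2 (hvs m) (hnot m), Submodule.mem_sup] at hmem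
    obtain ⟨y, hy, z, hz, hyz⟩ := hmem
    have hzU : z ∈ U m' := by
      refine (Submodule.span_singleton_le_iff_mem _ _).2 ?_ hz
      exact hU.monotone (Nat.succ_le_of_lt hlt) (hv m)
    have hyU : y ∈ U m' := by
      refine hs m' ⟨?_, he ▸ hy⟩
      rw [eq_sub_of_add_eq hyz]
      exact Submodule.sub_mem _ (hv m') (hU.1 _ hzU)
    exact hv' m' (hyz ▸ Submodule.add_mem _ hyU hzU)
  have hinj : Function.Injective s := by
    intro m m' he
    rcases lt_trichotomy m m' with h | h | h
    · exact absurd he (hne _ _ h)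
    · exact h
    · exact absurd he.symm (hne _ _ h)
  have htop : ⊤ ≤ Submodule.span k (Set.range v) := by
    rw [← hU.2.2 r le_rfl, hU.eq_span_of_mem_of_notMem hv hv' le_rfl]
    exact Submodule.span_mono (Set.image_subset_range _ _)
  let b := basisOfTopLeSpanOfCardEqFinrank v htop (by simp)
  have hb : ∀ m, b m = v m := fun m => by simp [b]
  refine ⟨b, Equiv.ofBijective s (Finite.injective_iff_bijective.1 hinj), ?_, ?_⟩
  · exact hU.eq_spanFlag_of_mem fun m => by simpa [hb] using hv m
  · exact hU'.eq_spanFlag_of_mem fun m => by simpa [hb] using hvs m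

end IsCompleteFlag

/-- Two pairs of complete flags in `V = k^r` lie in the same orbit of the
diagonal `GL(V)`-action iff all intersection dimensions `dim (Uᵢ ⊓ U′ⱼ)`
coincide; moreover the number of `GL(V)`-orbits on pairs of complete flags
(i.e. the number of values taken by the intersection-dimension matrix) is
`r!`. -/
theorem orbits_on_pairs_of_complete_flags
    (k : Type*) [Field k] (r : ℕ) (hr : 1 ≤ r) :
    (∀ U U' W W' : ℕ → Submodule k (Fin r → k),
      IsCompleteFlag k r U → IsCompleteFlag k r U' →
      IsCompleteFlag k r W → IsCompleteFlag k r W' →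
      (sameOrbitPairs k r U U' W W' ↔
        ∀ i ≤ r, ∀ j ≤ r, finrank k (U i ⊓ U' j : Submodule k (Fin r → k))
          = finrank k (W i ⊓ W' j : Submodule k (Fin r → k)))) ∧
    Nat.card (Set.range fun p :
        {p : (ℕ → Submodule k (Fin r → k)) × (ℕ → Submodule k (Fin r → k)) //
          IsCompleteFlag k r p.1 ∧ IsCompleteFlag k r p.2} =>
      fun i j : ℕ => finrank k (p.1.1 i ⊓ p.1.2 j : Submodule k (Fin r → k)))
      = r.factorial := by
  refine ⟨fun U U' W W' hU hU' hW hW' => ⟨?_, fun h => ?_⟩, ?_⟩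
  · rintro ⟨g, hg, hg'⟩ i - j -
    rw [← hg, ← hg', ← Submodule.map_inf _ g.injective]
    exact (LinearEquiv.finrank_map_eq g _).symm
  · obtain ⟨b, σ, rfl, rfl⟩ := hU.exists_eq_spanFlag hU'
    obtain ⟨c, τ, rfl, rfl⟩ := hW.exists_eq_spanFlag hW'
    simp only [finrank_spanFlag_inf] at h
    obtain rfl := perm_eq_of_permRank_eq h
    exact ⟨b.equiv c (Equiv.refl _), map_spanFlag b c 1, map_spanFlag b c σ⟩
  · have hinj : Function.Injective (permRank (r := r)) := fun σ τ h =>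
      perm_eq_of_permRank_eq fun i _ j _ => by rw [h]
    have hrange : (Set.range fun p :
        {p : (ℕ → Submodule k (Fin r → k)) × (ℕ → Submodule k (Fin r → k)) //
          IsCompleteFlag k r p.1 ∧ IsCompleteFlag k r p.2} =>
        fun i j : ℕ => finrank k (p.1.1 i ⊓ p.1.2 j : Submodule k (Fin r → k))) =
        Set.range (permRank (r := r)) := by
      ext f
      constructor
      · rintro ⟨⟨⟨U, U'⟩, hU, hU'⟩, rfl⟩
        obtain ⟨b, σ, rfl, rfl⟩ := hU.exists_eq_spanFlag hU'
        exact ⟨σ, funext₂ fun i j => (finrank_spanFlag_inf b σ i j).symm⟩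
      · rintro ⟨σ, rfl⟩
        let b := Pi.basisFun k (Fin r)
        exact ⟨⟨(spanFlag b 1, spanFlag b σ),
          isCompleteFlag_spanFlag b 1, isCompleteFlag_spanFlag b σ⟩,
          funext₂ fun i j => finrank_spanFlag_inf b σ i j⟩
    rw [hrange, Nat.card_range_of_injective hinj, Nat.card_eq_fintype_card, Fintype.card_perm,
      Fintype.card_fin]
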